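/- (Hertz's improved Hoeffding inequality) Let X be a real-valued random variable on a probability space with E[X] = 0 and X ∈ [a, b] almost surely, where a < 0 < b. Then for every real s > 0, E[exp(sX)] ≤ exp( (s²/2) · Φ(a,b)² ), where Φ(a,b) = (|a|+b)/2 if b > |a| and Φ(a,b) = √(|a|·b) if b ≤ |a|. -/

import Mathlib

open MeasureTheory Real ProbabilityTheory
open scoped ProbabilityTheory

noncomputable def Phi (a b : ℝ) : ℝ := if b > |a| then (|a| + b) / 2 else Real.sqrt (|a| * b)

lemma one_sub_mul_exp_two_mul_le {y : ℝ} (hy : 0 ≤ y) (hy1 : y < 1) :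
    (1 - y) * exp (2 * y) ≤ 1 + y := by
  have h1 : 0 < 1 - y := by linarith
  have h := Real.le_log_one_add_of_nonneg (x := 2 * y / (1 - y)) (by positivity)
  have e1 : 2 * (2 * y / (1 - y)) / (2 * y / (1 - y) + 2) = 2 * y := by
    have : 2 * y / (1 - y) + 2 = 2 / (1 - y) := by field_simp; ring
    rw [this]; field_simp
  have e2 : 1 + 2 * y / (1 - y) = (1 + y) / (1 - y) := by field_simp; ring
  rw [e1, e2, Real.le_log_iff_exp_le (by positivity), le_div_iff₀ h1] at h
  linarith

lemma exp_mul_one_sub_le_exp_neg_mul_one_add {x y : ℝ} (hy : 0 ≤ y) (hyx : y ≤ x) :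
    exp y * (1 - x) ≤ exp (-x) * (1 + y) := by
  rcases le_or_gt 1 x with hx | hx
  · exact (mul_nonpos_of_nonneg_of_nonpos (exp_pos y).le (by linarith)).trans (by positivity)
  have h1 := one_sub_mul_exp_two_mul_le hy (by linarith)
  have h2 : 1 - x ≤ (1 - y) * exp (y - x) := by
    nlinarith [Real.add_one_le_exp (y - x), mul_nonneg hy (sub_nonneg.2 hyx)]
  calc exp y * (1 - x) ≤ exp y * ((1 - y) * exp (y - x)) := by gcongr
    _ = exp (-x) * ((1 - y) * exp (2 * y)) := by
      rw [show 2 * y = y + y by ring, show y - x = y + -x by ring, exp_add, exp_add]; ring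
    _ ≤ exp (-x) * (1 + y) := by gcongr

/-- The moment generating function of the centred law on `{-c, b}` is subgaussian with variance
proxy `c * b` when `b ≤ c`. -/
lemma mul_exp_add_mul_exp_le {b c s : ℝ} (hb : 0 < b) (hbc : b ≤ c) (hs : 0 ≤ s) :
    b * exp (-(s * c)) + c * exp (s * b) ≤ (c + b) * exp (s ^ 2 / 2 * (c * b)) := by
  let h : ℝ → ℝ := fun t ↦
    (b * exp (-(t * c)) + c * exp (t * b)) * exp (-(t ^ 2 / 2 * (c * b)))
  have hd (t : ℝ) : HasDerivAt h
      (c * b * exp (-(t ^ 2 / 2 * (c * b))) *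
        (exp (t * b) * (1 - t * c) - exp (-(t * c)) * (1 + t * b))) t := by
    have d1 := (((hasDerivAt_id t).mul_const c).neg.exp).const_mul b
    have d2 := (((hasDerivAt_id t).mul_const b).exp).const_mul c
    have d3 := (((((hasDerivAt_id t).pow 2).div_const 2).mul_const (c * b)).neg).exp
    refine ((d1.add d2).mul d3).congr_deriv ?_
    simp
    ring
  have hanti : AntitoneOn h (Set.Ici 0) := by
    refine antitoneOn_of_deriv_nonpos (convex_Ici 0)
      (fun t _ ↦ (hd t).continuousAt.continuousWithinAt)
      (fun t _ ↦ (hd t).differentiableAt.differentiableWithinAt) fun t ht ↦ ?_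
    rw [interior_Ici] at ht
    have ht : 0 < t := ht
    rw [(hd t).deriv]
    refine mul_nonpos_of_nonneg_of_nonpos (by have := hb.trans_le hbc; positivity) ?_
    linarith [exp_mul_one_sub_le_exp_neg_mul_one_add (x := t * c) (y := t * b)
      (by positivity) (by gcongr)]
  have h0 := hanti (Set.mem_Ici.2 le_rfl) (Set.mem_Ici.2 hs) hs
  simp only [h, exp_neg (s ^ 2 / 2 * (c * b))] at h0
  rw [mul_inv_le_iff₀ (exp_pos _)] at h0
  simpa [add_comm] using h0

lemma exp_mul_le_chord {a b s x : ℝ} (hab : a < b) (hx : x ∈ Set.Icc a b) :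
    exp (s * x) ≤ (b - x) / (b - a) * exp (s * a) + (x - a) / (b - a) * exp (s * b) := by
  have hba : 0 < b - a := sub_pos.2 hab
  have h := convexOn_exp.2 (Set.mem_univ (s * a)) (Set.mem_univ (s * b))
    (div_nonneg (sub_nonneg.2 hx.2) hba.le) (div_nonneg (sub_nonneg.2 hx.1) hba.le)
    (by field_simp; ring)
  simp only [smul_eq_mul] at h
  rwa [show (b - x) / (b - a) * (s * a) + (x - a) / (b - a) * (s * b) = s * x by
    field_simp; ring] at h

lemma integral_exp_mul_le_two_point {Ω : Type*} {mΩ : MeasurableSpace Ω} {μ : Measure Ω}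
    [IsProbabilityMeasure μ] {X : Ω → ℝ} (hX : AEMeasurable X μ) {a b : ℝ} (hab : a < b)
    (hmem : ∀ᵐ ω ∂μ, X ω ∈ Set.Icc a b) (hmean : ∫ ω, X ω ∂μ = 0) (s : ℝ) :
    ∫ ω, exp (s * X ω) ∂μ ≤ (b * exp (s * a) - a * exp (s * b)) / (b - a) := by
  have hint : Integrable X μ := Integrable.of_mem_Icc a b hX hmem
  have hba : b - a ≠ 0 := (sub_pos.2 hab).ne'
  let m := (exp (s * b) - exp (s * a)) / (b - a)
  let k := (b * exp (s * a) - a * exp (s * b)) / (b - a)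
  have hlin : Integrable (fun ω ↦ m * X ω + k) μ := (hint.const_mul m).add (integrable_const k)
  calc ∫ ω, exp (s * X ω) ∂μ ≤ ∫ ω, (m * X ω + k) ∂μ := by
        refine integral_mono_of_nonneg (.of_forall fun _ ↦ (exp_pos _).le) hlin ?_
        filter_upwards [hmem] with ω hω
        refine (exp_mul_le_chord hab hω).trans_eq ?_
        simp only [m, k]
        field_simp
        ring
    _ = k := by
        rw [integral_add (hint.const_mul m) (integrable_const k), integral_const_mul, hmean]
        simp

theorem stmt_4 {Ω : Type*} [MeasureSpace Ω] [IsProbabilityMeasure (ℙ : Measure Ω)]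
    (X : Ω → ℝ) (hX : Measurable X) (a b : ℝ) (ha : a < 0) (hb : 0 < b)
    (hmem : ∀ᵐ ω, X ω ∈ Set.Icc a b) (hmean : ∫ ω, X ω = 0)
    (s : ℝ) (hs : 0 < s) :
    ∫ ω, Real.exp (s * X ω) ≤ Real.exp (s ^ 2 / 2 * (Phi a b) ^ 2) := by
  unfold Phi
  split_ifs with h
  · have hsub := (hasSubgaussianMGF_of_mem_Icc_of_integral_eq_zero hX.aemeasurable hmem
      hmean).mgf_le s
    rw [mgf] at hsub
    refine hsub.trans_eq ?_
    congr 1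
    rw [abs_of_neg ha]
    simp only [NNReal.coe_pow, NNReal.coe_div, coe_nnnorm, Real.norm_eq_abs,
      abs_of_pos (show 0 < b - a by linarith), NNReal.coe_ofNat]
    ring
  · have hba : 0 < b - a := by linarith
    rw [Real.sq_sqrt (by positivity), abs_of_neg ha]
    rw [abs_of_neg ha, gt_iff_lt, not_lt] at h
    refine (integral_exp_mul_le_two_point hX.aemeasurable (ha.trans hb) hmem hmean s).trans ?_
    rw [div_le_iff₀ hba]
    have key := mul_exp_add_mul_exp_le hb h hs.le
    rw [mul_neg, neg_neg] at key
    linarith
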